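/- arXiv:2202.05687 — 3 statements merged into one kernel-verified Lean document; each statement's English description precedes it below -/
import Mathlib

section
/- (Lemma 3.1, at-least-one voting, tightness in aggregated form.) Let d, n be positive integers, let g_1, …, g_n be vectors in the Euclidean space ℝ^d that are pairwise orthogonal and not all zero, and let γ_1, …, γ_n > 0 and ε > 0 be real numbers. Set k = min(d, ⌊ε² · (Σ_{j=1}^{n} ‖g_j‖₂²) / (Σ_{j=1}^{n} γ_j)²⌋). If k ≥ 1, then there exist pairwise orthogonal vectors r_1, …, r_k in ℝ^d such that ‖r_i‖₂ ≤ ε and ⟨Σ_{j=1}^{n} g_j, r_i⟩ ≥ Σ_{j=1}^{n} γ_j for every 1 ≤ i ≤ k. -/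
open scoped RealInnerProductSpace

/-- The square of the norm of a finite sum of pairwise orthogonal vectors is the sum of the squares
of their norms. -/
theorem norm_sum_sq_of_pairwise_orthogonal {ι E : Type*} [Fintype ι] [NormedAddCommGroup E]
    [InnerProductSpace ℝ E] {v : ι → E} (hv : ∀ i j, i ≠ j → ⟪v i, v j⟫ = 0) :
    ‖∑ i, v i‖ ^ 2 = ∑ i, ‖v i‖ ^ 2 := by
  simp_rw [← real_inner_self_eq_norm_sq, sum_inner, inner_sum]
  exact Finset.sum_congr rfl fun i _ => Fintype.sum_eq_single i fun j hj => hv i j hj.symm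

/-- Any vector of a Euclidean space has equal inner products `‖x‖ / √k` with the members of some
orthonormal family of `k` vectors, for every positive `k` at most the dimension. -/
theorem EuclideanSpace.exists_orthonormal_inner_eq {d k : ℕ} (hk : 0 < k) (hkd : k ≤ d)
    (x : EuclideanSpace ℝ (Fin d)) :
    ∃ v : Fin k → EuclideanSpace ℝ (Fin d),
      Orthonormal ℝ v ∧ ∀ i, ⟪x, v i⟫ = ‖x‖ / √k := by
  obtain ⟨e, he⟩ : ∃ e : Fin k → EuclideanSpace ℝ (Fin d), Orthonormal ℝ e :=
    ⟨_, (EuclideanSpace.basisFun (Fin d) ℝ).orthonormal.comp _ (Fin.castLE_injective hkd)⟩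
  have hk' : (0 : ℝ) < √k := Real.sqrt_pos.2 (Nat.cast_pos.2 hk)
  set w := (‖x‖ / √k) • ∑ i, e i with hw
  have hsum : ‖∑ i, e i‖ = √k := by
    rw [eq_comm, Real.sqrt_eq_iff_eq_sq (Nat.cast_nonneg k) (norm_nonneg _),
      norm_sum_sq_of_pairwise_orthogonal fun i j hij => he.2 hij]
    simp [he.1]
  have hnorm : ‖w‖ = ‖x‖ := by
    rw [hw, norm_smul, hsum, Real.norm_of_nonneg (by positivity), div_mul_cancel₀ _ hk'.ne']
  let R := (ℝ ∙ (w - x))ᗮ.reflection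
  have hR : R w = x := Submodule.reflection_sub hnorm
  refine ⟨R ∘ e, he.comp_linearIsometryEquiv R, fun i => ?_⟩
  have hwi : ⟪w, e i⟫ = ‖x‖ / √k := by
    rw [hw, real_inner_smul_left, sum_inner, Fintype.sum_eq_single i fun j hj => he.2 hj,
      real_inner_self_eq_norm_sq, he.1, one_pow, mul_one]
  rw [← hwi, ← R.inner_map_map w (e i), hR, Function.comp_apply]

/-- Lemma 3.1, at-least-one voting, tightness in aggregated form: with
k = min(d, ⌊ε² (Σ_j ‖g_j‖²) / (Σ_j γ_j)²⌋) ≥ 1, there exist k pairwise orthogonal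
perturbations of ℓ2 norm at most ε with ⟨Σ_j g_j, r_i⟩ ≥ Σ_j γ_j. -/
theorem stmt_3 (d n : ℕ) (hd : 0 < d) (hn : 0 < n)
    (g : Fin n → EuclideanSpace ℝ (Fin d))
    (hgorth : ∀ i j, i ≠ j → ⟪g i, g j⟫ = 0)
    (hg : ∃ j, g j ≠ 0)
    (γ : Fin n → ℝ) (hγ : ∀ j, 0 < γ j)
    (ε : ℝ) (hε : 0 < ε)
    (k : ℕ)
    (hk : k = min d (⌊ε ^ 2 * (∑ j, ‖g j‖ ^ 2) / (∑ j, γ j) ^ 2⌋.toNat))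
    (hk1 : 1 ≤ k) :
    ∃ r : Fin k → EuclideanSpace ℝ (Fin d),
      (∀ i j, i ≠ j → ⟪r i, r j⟫ = 0) ∧
      (∀ i, ‖r i‖ ≤ ε) ∧
      (∀ i, (∑ j, γ j) ≤ ⟪∑ j, g j, r i⟫) := by
  have : Nonempty (Fin n) := ⟨⟨0, hn⟩⟩
  have hS : 0 < ∑ j, γ j := Finset.sum_pos (fun j _ => hγ j) Finset.univ_nonempty
  have hk0 : (0 : ℝ) < k := Nat.cast_pos.2 hk1
  obtain ⟨v, hv, hinner⟩ := EuclideanSpace.exists_orthonormal_inner_eq hk1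
    (hk.le.trans (min_le_left _ _)) (∑ j, g j)
  refine ⟨fun i => ε • v i, fun i j hij => ?_, fun i => ?_, fun i => ?_⟩
  · rw [real_inner_smul_left, real_inner_smul_right, hv.2 hij, mul_zero, mul_zero]
  · rw [norm_smul, hv.1, mul_one, Real.norm_of_nonneg hε.le]
  · have hfloor : (k : ℝ) ≤ ε ^ 2 * ‖∑ j, g j‖ ^ 2 / (∑ j, γ j) ^ 2 := by
      rw [norm_sum_sq_of_pairwise_orthogonal hgorth]
      exact (Nat.le_floor_iff' (Nat.ne_of_gt hk1)).1 (hk.le.trans (min_le_right _ _))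
    rw [real_inner_smul_right, hinner, ← mul_div_assoc, le_div_iff₀ (Real.sqrt_pos.2 hk0)]
    refine le_of_sq_le_sq ?_ (by positivity)
    rw [le_div_iff₀ (by positivity)] at hfloor
    rw [mul_pow, mul_pow, Real.sq_sqrt hk0.le, mul_comm]
    exact hfloor
end

section
/- (Lemma 3.1, majority voting, max-form upper bound.) Let d, n be positive integers, let g_1, …, g_n be vectors in the Euclidean space ℝ^d that are pairwise orthogonal, and let γ_1, …, γ_n > 0 and ε > 0 be real numbers. Suppose there exists a subset K ⊆ {1, …, n} with |K| = ⌈n/2⌉ and pairwise orthogonal nonzero vectors r_1, …, r_k in ℝ^d satisfying ‖r_i‖₂ ≤ ε and ⟨g_j, r_i⟩ ≥ γ_j for all 1 ≤ i ≤ k and all j ∈ K. Then k ≤ min(d, ⌊ max over subsets K' ⊆ {1, …, n} with |K'| = ⌈n/2⌉ of ε² · (Σ_{j∈K'} ‖g_j‖₂²) / (Σ_{j∈K'} γ_j)² ⌋). -/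
open scoped RealInnerProductSpace

/-- The squared norm of a sum of pairwise orthogonal vectors is the sum of the squared norms. -/
theorem norm_sq_sum_of_pairwise_inner_eq_zero {ι E : Type*} [NormedAddCommGroup E]
    [InnerProductSpace ℝ E] (g : ι → E) (s : Finset ι)
    (hg : ∀ i j, i ≠ j → ⟪g i, g j⟫ = 0) :
    ‖∑ j ∈ s, g j‖ ^ 2 = ∑ j ∈ s, ‖g j‖ ^ 2 := by
  rw [← real_inner_self_eq_norm_sq, sum_inner]
  refine Finset.sum_congr rfl fun i hi => ?_
  rw [inner_sum, Finset.sum_eq_single_of_mem i hi fun j _ hji => hg i j hji.symm,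
    real_inner_self_eq_norm_sq]

/-- At most `ε² ‖v‖² / c²` pairwise orthogonal nonzero vectors of norm at most `ε` can have inner
product at least `c > 0` with `v`. -/
theorem card_mul_sq_le_of_le_inner {ι E : Type*} [Fintype ι] [NormedAddCommGroup E]
    [InnerProductSpace ℝ E] {r : ι → E} (hr0 : ∀ i, r i ≠ 0)
    (horth : ∀ i j, i ≠ j → ⟪r i, r j⟫ = 0) {ε c : ℝ} (hnorm : ∀ i, ‖r i‖ ≤ ε)
    (hc : 0 < c) {v : E} (hv : ∀ i, c ≤ ⟪v, r i⟫) :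
    Fintype.card ι * c ^ 2 ≤ ε ^ 2 * ‖v‖ ^ 2 := by
  have hpos : ∀ i, 0 < ‖r i‖ := fun i => norm_pos_iff.2 (hr0 i)
  have hon : Orthonormal ℝ fun i => (‖r i‖⁻¹ : ℝ) • r i := by
    refine ⟨fun i => ?_, fun i j hij => ?_⟩
    · rw [norm_smul, norm_inv, norm_norm, inv_mul_cancel₀ (hpos i).ne']
    · simp only [real_inner_smul_left, real_inner_smul_right, horth i j hij, mul_zero]
  have hterm : ∀ i, c ^ 2 ≤ ε ^ 2 * ‖⟪(‖r i‖⁻¹ : ℝ) • r i, v⟫‖ ^ 2 := fun i => by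
    have hi : c ≤ ‖r i‖ * ⟪(‖r i‖⁻¹ : ℝ) • r i, v⟫ := by
      rw [real_inner_smul_left, mul_inv_cancel_left₀ (hpos i).ne', real_inner_comm]
      exact hv i
    calc c ^ 2 ≤ (‖r i‖ * ⟪(‖r i‖⁻¹ : ℝ) • r i, v⟫) ^ 2 := pow_le_pow_left₀ hc.le hi 2
      _ = ‖r i‖ ^ 2 * ‖⟪(‖r i‖⁻¹ : ℝ) • r i, v⟫‖ ^ 2 := by rw [mul_pow, Real.norm_eq_abs, sq_abs]
      _ ≤ _ := by gcongr; exact hnorm i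
  calc (Fintype.card ι : ℝ) * c ^ 2 = ∑ _i : ι, c ^ 2 := by simp
    _ ≤ ∑ i, ε ^ 2 * ‖⟪(‖r i‖⁻¹ : ℝ) • r i, v⟫‖ ^ 2 := Finset.sum_le_sum fun i _ => hterm i
    _ = ε ^ 2 * ∑ i, ‖⟪(‖r i‖⁻¹ : ℝ) • r i, v⟫‖ ^ 2 := by rw [Finset.mul_sum]
    _ ≤ _ := by gcongr; exact hon.sum_inner_products_le v

/-- Lemma 3.1, majority voting, max-form upper bound: if some target set K of ⌈n/2⌉
models is fooled by k pairwise orthogonal nonzero perturbations of ℓ2 norm at most ε,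
then k ≤ min(d, ⌊max_{|K'|=⌈n/2⌉} ε² (Σ_{j∈K'} ‖g_j‖²) / (Σ_{j∈K'} γ_j)²⌋). -/
theorem stmt_5 (d n k : ℕ) (hd : 0 < d) (hn : 0 < n)
    (g : Fin n → EuclideanSpace ℝ (Fin d))
    (hgorth : ∀ i j, i ≠ j → ⟪g i, g j⟫ = 0)
    (γ : Fin n → ℝ) (hγ : ∀ j, 0 < γ j)
    (ε : ℝ) (hε : 0 < ε)
    (K : Finset (Fin n)) (hK : K.card = (n + 1) / 2)
    (r : Fin k → EuclideanSpace ℝ (Fin d))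
    (hr0 : ∀ i, r i ≠ 0)
    (horth : ∀ i j, i ≠ j → ⟪r i, r j⟫ = 0)
    (hnorm : ∀ i, ‖r i‖ ≤ ε)
    (hip : ∀ i, ∀ j ∈ K, γ j ≤ ⟪g j, r i⟫) :
    (k : ℝ) ≤ min (d : ℝ)
      ((⌊sSup {x : ℝ | ∃ K' : Finset (Fin n), K'.card = (n + 1) / 2 ∧
          x = ε ^ 2 * (∑ j ∈ K', ‖g j‖ ^ 2) / (∑ j ∈ K', γ j) ^ 2}⌋ : ℤ) : ℝ) := by
  refine le_min ?_ ?_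
  · have hli : LinearIndependent ℝ r :=
      linearIndependent_of_ne_zero_of_inner_eq_zero hr0 horth
    simpa using hli.fintype_card_le_finrank
  · rw [← Int.cast_natCast, Int.cast_le, Int.le_floor, Int.cast_natCast]
    have hKne : K.Nonempty := Finset.card_pos.1 (by omega)
    have hc : 0 < ∑ j ∈ K, γ j := Finset.sum_pos (fun j _ => hγ j) hKne
    have hfin : {x : ℝ | ∃ K' : Finset (Fin n), K'.card = (n + 1) / 2 ∧
        x = ε ^ 2 * (∑ j ∈ K', ‖g j‖ ^ 2) / (∑ j ∈ K', γ j) ^ 2}.Finite := by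
      refine (Set.finite_range fun K' : Finset (Fin n) =>
        ε ^ 2 * (∑ j ∈ K', ‖g j‖ ^ 2) / (∑ j ∈ K', γ j) ^ 2).subset ?_
      rintro x ⟨K', -, rfl⟩
      exact ⟨K', rfl⟩
    refine le_trans ?_ (le_csSup hfin.bddAbove ⟨K, hK, rfl⟩)
    rw [le_div_iff₀ (by positivity), ← norm_sq_sum_of_pairwise_inner_eq_zero g K hgorth]
    have hv : ∀ i, ∑ j ∈ K, γ j ≤ ⟪∑ j ∈ K, g j, r i⟫ := fun i => by
      rw [sum_inner]
      exact Finset.sum_le_sum (hip i)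
    simpa using card_mul_sq_le_of_le_inner hr0 horth hnorm hc hv
end

section
/- (Takeaway corollary of Lemma 3.1 for near-identical models.) Let d, n be positive integers, let g_1, …, g_n be pairwise orthogonal vectors in the Euclidean space ℝ^d with ‖g_j‖₂ = ‖g_1‖₂ for all j, and let γ_1, …, γ_n > 0 with γ_j = γ_1 for all j, and let ε > 0. If r_1, …, r_k are pairwise orthogonal nonzero vectors in ℝ^d satisfying ‖r_i‖₂ ≤ ε and ⟨g_j, r_i⟩ ≥ γ_j for all 1 ≤ i ≤ k and all 1 ≤ j ≤ n, then k ≤ min(d, ⌊ε²‖g_1‖₂² / (n·γ_1²)⌋); i.e., the bound is a factor n smaller than the single-model bound ⌊ε²‖g_1‖₂²/γ_1²⌋. -/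
open scoped RealInnerProductSpace

theorem norm_sum_sq_of_pairwise_inner_eq_zero {ι E : Type*} [Fintype ι]
    [NormedAddCommGroup E] [InnerProductSpace ℝ E] (v : ι → E)
    (hv : ∀ i j, i ≠ j → ⟪v i, v j⟫ = 0) : ‖∑ i, v i‖ ^ 2 = ∑ i, ‖v i‖ ^ 2 := by
  rw [← real_inner_self_eq_norm_sq, sum_inner]
  refine Finset.sum_congr rfl fun i _ => ?_
  rw [inner_sum, Finset.sum_eq_single i (fun j _ hj => hv i j hj.symm) (by simp),
    real_inner_self_eq_norm_sq]

/-- Cauchy–Schwarz for the sums of two finite orthogonal families whose mutual inner products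
are all at least `c`. -/
theorem card_mul_card_mul_sq_le_of_le_inner {ι κ E : Type*} [Fintype ι] [Fintype κ]
    [NormedAddCommGroup E] [InnerProductSpace ℝ E] (u : ι → E) (v : κ → E)
    (hu : ∀ i j, i ≠ j → ⟪u i, u j⟫ = 0) (hv : ∀ i j, i ≠ j → ⟪v i, v j⟫ = 0)
    {c : ℝ} (hc : 0 ≤ c) (huv : ∀ i j, c ≤ ⟪u i, v j⟫) :
    (Fintype.card ι * Fintype.card κ * c) ^ 2 ≤ (∑ i, ‖u i‖ ^ 2) * ∑ j, ‖v j‖ ^ 2 := by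
  have h_inner : Fintype.card ι * Fintype.card κ * c ≤ ⟪∑ i, u i, ∑ j, v j⟫ := by
    simp_rw [sum_inner, inner_sum]
    calc (Fintype.card ι * Fintype.card κ * c : ℝ) = ∑ _i : ι, ∑ _j : κ, c := by
          simp [mul_assoc]
      _ ≤ _ := Finset.sum_le_sum fun i _ => Finset.sum_le_sum fun j _ => huv i j
  rw [← norm_sum_sq_of_pairwise_inner_eq_zero u hu,
    ← norm_sum_sq_of_pairwise_inner_eq_zero v hv, ← mul_pow]
  exact pow_le_pow_left₀ (by positivity) (h_inner.trans (real_inner_le_norm _ _)) 2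

/-- Takeaway corollary of Lemma 3.1 for near-identical models: if all n disjoint models
have gradients of equal norm and equal thresholds, then the number of pairwise
orthogonal nonzero perturbations of ℓ2 norm at most ε fooling all n models is at most
min(d, ⌊ε²‖g_1‖²/(n γ_1²)⌋), a factor n smaller than the single-model bound. -/
theorem stmt_7 (d n k : ℕ) (hd : 0 < d) (hn : 0 < n)
    (g : Fin n → EuclideanSpace ℝ (Fin d))
    (hgorth : ∀ i j, i ≠ j → ⟪g i, g j⟫ = 0)
    (hgeq : ∀ j, ‖g j‖ = ‖g ⟨0, hn⟩‖)
    (γ : Fin n → ℝ) (hγ : ∀ j, 0 < γ j)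
    (hγeq : ∀ j, γ j = γ ⟨0, hn⟩)
    (ε : ℝ) (hε : 0 < ε)
    (r : Fin k → EuclideanSpace ℝ (Fin d))
    (hr0 : ∀ i, r i ≠ 0)
    (horth : ∀ i j, i ≠ j → ⟪r i, r j⟫ = 0)
    (hnorm : ∀ i, ‖r i‖ ≤ ε)
    (hip : ∀ i j, γ j ≤ ⟪g j, r i⟫) :
    (k : ℝ) ≤ min (d : ℝ)
      ((⌊ε ^ 2 * ‖g ⟨0, hn⟩‖ ^ 2 / ((n : ℝ) * γ ⟨0, hn⟩ ^ 2)⌋ : ℤ) : ℝ) := by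
  refine le_min ?_ ?_
  · have h_indep : LinearIndependent ℝ r :=
      linearIndependent_of_ne_zero_of_inner_eq_zero hr0 fun i j hij => horth i j hij
    have h_card := h_indep.fintype_card_le_finrank
    rw [Fintype.card_fin, finrank_euclideanSpace_fin] at h_card
    exact_mod_cast h_card
  · have hγ0 : 0 < γ ⟨0, hn⟩ := hγ _
    have hn' : (0 : ℝ) < n := by exact_mod_cast hn
    have h_floor : (k : ℤ) ≤ ⌊ε ^ 2 * ‖g ⟨0, hn⟩‖ ^ 2 / ((n : ℝ) * γ ⟨0, hn⟩ ^ 2)⌋ := by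
      rw [Int.le_floor, le_div_iff₀ (by positivity), Int.cast_natCast]
      rcases Nat.eq_zero_or_pos k with rfl | hk
      · simp only [Nat.cast_zero, zero_mul]
        positivity
      have hk' : (0 : ℝ) < k := by exact_mod_cast hk
      have h_cs := card_mul_card_mul_sq_le_of_le_inner g r hgorth horth hγ0.le
        fun j i => (hγeq j).ge.trans (hip i j)
      have h_sum_g : ∑ j, ‖g j‖ ^ 2 = n * ‖g ⟨0, hn⟩‖ ^ 2 := by
        simp_rw [hgeq]
        simp
      have h_sum_r : ∑ i, ‖r i‖ ^ 2 ≤ k * ε ^ 2 := by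
        calc ∑ i, ‖r i‖ ^ 2 ≤ ∑ _i : Fin k, ε ^ 2 :=
              Finset.sum_le_sum fun i _ => pow_le_pow_left₀ (norm_nonneg _) (hnorm i) 2
          _ = k * ε ^ 2 := by simp
      rw [h_sum_g, Fintype.card_fin, Fintype.card_fin] at h_cs
      refine le_of_mul_le_mul_left ?_ (mul_pos hn' hk')
      calc (n * k : ℝ) * (k * (n * γ ⟨0, hn⟩ ^ 2)) = (n * k * γ ⟨0, hn⟩) ^ 2 := by ring
        _ ≤ n * ‖g ⟨0, hn⟩‖ ^ 2 * ∑ i, ‖r i‖ ^ 2 := h_cs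
        _ ≤ n * ‖g ⟨0, hn⟩‖ ^ 2 * (k * ε ^ 2) := by gcongr
        _ = n * k * (ε ^ 2 * ‖g ⟨0, hn⟩‖ ^ 2) := by ring
    exact_mod_cast h_floor
end
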